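/- arXiv:2309.12526 — 2 statements merged into one kernel-verified Lean document; each statement's English description precedes it below -/
import Mathlib

section
/- Let μ be a probability measure on a measurable space Ω and ν a probability measure on a measurable space Ω'. Let R_d : Ω → ℝ be integrable and nonnegative, and let R_r : Ω × Ω' → ℝ be nonnegative and integrable with respect to the product measure μ.prod ν. Let A ≥ 0 and 0 < C ≤ B be real constants, and define Λ(λ, ω) = ∫ max(A·R_r(ω, ω') − λ·B, −λ·C) dν(ω') and F(λ) = ∫ max((R_d(ω) − λ)·B, Λ(λ, ω), 0) dμ(ω). Then for every τ_o > 0 there exists a unique λ* ≥ 0 such that F(λ*) = λ*·τ_o. -/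
open MeasureTheory

/-- A continuous antitone function that is nonnegative at `0` meets every line of positive slope
through the origin exactly once on the nonnegative half-line. -/
theorem existsUnique_eq_mul_of_antitone_of_continuous {F : ℝ → ℝ} (hF : Antitone F)
    (hc : Continuous F) (h0 : 0 ≤ F 0) {τ : ℝ} (hτ : 0 < τ) :
    ∃! x : ℝ, 0 ≤ x ∧ F x = x * τ := by
  have hx : 0 ≤ F 0 / τ := div_nonneg h0 hτ.le
  obtain ⟨x, hxm, hxe⟩ : (0 : ℝ) ∈ (fun x => F x - x * τ) '' Set.Icc 0 (F 0 / τ) := by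
    refine intermediate_value_Icc' hx (by fun_prop) ⟨?_, by simpa using h0⟩
    have := hF hx
    simp only [div_mul_cancel₀ _ hτ.ne']
    linarith
  refine ⟨x, ⟨hxm.1, sub_eq_zero.mp hxe⟩, ?_⟩
  have hs : StrictAnti fun x => F x - x * τ := fun a b hab => by
    have := hF hab.le
    have := mul_lt_mul_of_pos_right hab hτ
    dsimp only
    linarith
  exact fun y hy => hs.injective ((sub_eq_zero.mpr hy.2).trans hxe.symm)

/-- Two-sided increment bounds pass to the integral against a probability measure. -/
theorem integral_increment_bounds {α : Type*} [MeasurableSpace α] {μ : Measure α}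
    [IsProbabilityMeasure μ] {f g : α → ℝ} (hf : Integrable f μ) (hg : Integrable g μ) {c : ℝ}
    (h : ∀ᵐ a ∂μ, g a ≤ f a ∧ f a ≤ g a + c) :
    ∫ a, g a ∂μ ≤ ∫ a, f a ∂μ ∧ ∫ a, f a ∂μ ≤ ∫ a, g a ∂μ + c := by
  refine ⟨integral_mono_ae hg hf (h.mono fun _ h => h.1), ?_⟩
  calc ∫ a, f a ∂μ ≤ ∫ a, (g a + c) ∂μ :=
        integral_mono_ae hf (hg.add (integrable_const c)) (h.mono fun _ h => h.2)
    _ = ∫ a, g a ∂μ + c := by rw [integral_add hg (integrable_const c)]; simp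

/-- Two-sided increment bounds are preserved by binary maxima. -/
theorem max_increment_bounds {a b a' b' c : ℝ} (h : a' ≤ a ∧ a ≤ a' + c)
    (h' : b' ≤ b ∧ b ≤ b' + c) : max a' b' ≤ max a b ∧ max a b ≤ max a' b' + c := by
  rw [← max_add_add_right]
  exact ⟨max_le_max h.1 h'.1, max_le_max h.2 h'.2⟩

/-- The maximal average system throughput `λ*` is uniquely determined by the
Bellman-type fixed-point equation `F(λ*) = λ* · τ_o`. -/
theorem bellman_fixed_point_unique
    {Ω Ω' : Type*} [MeasurableSpace Ω] [MeasurableSpace Ω']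
    (μ : Measure Ω) (ν : Measure Ω')
    [IsProbabilityMeasure μ] [IsProbabilityMeasure ν]
    (R_d : Ω → ℝ) (hRd_int : Integrable R_d μ) (hRd_nonneg : ∀ ω, 0 ≤ R_d ω)
    (R_r : Ω × Ω' → ℝ) (hRr_nonneg : ∀ p, 0 ≤ R_r p)
    (hRr_int : Integrable R_r (μ.prod ν))
    (A B C : ℝ) (hA : 0 ≤ A) (hC : 0 < C) (hCB : C ≤ B)
    (Λ : ℝ → Ω → ℝ)
    (hΛ : ∀ lam ω, Λ lam ω = ∫ ω', max (A * R_r (ω, ω') - lam * B) (-lam * C) ∂ν)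
    (F : ℝ → ℝ)
    (hF : ∀ lam, F lam = ∫ ω, max ((R_d ω - lam) * B) (max (Λ lam ω) 0) ∂μ)
    (τo : ℝ) (hτo : 0 < τo) :
    ∃! lam : ℝ, 0 ≤ lam ∧ F lam = lam * τo := by
  have hB : 0 ≤ B := hC.le.trans hCB
  have hΛ_eq : Λ = fun lam ω => ∫ ω', max (A * R_r (ω, ω') - lam * B) (-lam * C) ∂ν := by
    ext; exact hΛ ..
  have hΛ_int (lam : ℝ) : Integrable (Λ lam) μ := by
    rw [hΛ_eq]
    exact Integrable.integral_prod_left (f := fun p => max (A * R_r p - lam * B) (-lam * C))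
      (((hRr_int.const_mul A).sub (integrable_const _)).sup (integrable_const _))
  have hF_int (lam : ℝ) :
      Integrable (fun ω => max ((R_d ω - lam) * B) (max (Λ lam ω) 0)) μ :=
    ((hRd_int.sub (integrable_const lam)).mul_const B).sup
      ((hΛ_int lam).sup (integrable_const 0))
  have hF_incr {x y : ℝ} (hxy : x ≤ y) : F y ≤ F x ∧ F x ≤ F y + B * (y - x) := by
    have hd : 0 ≤ y - x := sub_nonneg.mpr hxy
    have hBd : 0 ≤ B * (y - x) := mul_nonneg hB hd
    have hCd : 0 ≤ C * (y - x) := mul_nonneg hC.le hd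
    have hCBd : C * (y - x) ≤ B * (y - x) := mul_le_mul_of_nonneg_right hCB hd
    rw [hF, hF]
    refine integral_increment_bounds (hF_int x) (hF_int y) ?_
    filter_upwards [hRr_int.prod_right_ae] with ω hω
    refine max_increment_bounds ⟨by linarith, by linarith⟩
      (max_increment_bounds ?_ ⟨le_rfl, by linarith⟩)
    have hint (lam : ℝ) :
        Integrable (fun ω' => max (A * R_r (ω, ω') - lam * B) (-lam * C)) ν :=
      ((hω.const_mul A).sub (integrable_const _)).sup (integrable_const _)
    rw [hΛ, hΛ]
    exact integral_increment_bounds (hint x) (hint y) (.of_forall fun ω' =>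
      max_increment_bounds ⟨by linarith, by linarith⟩ ⟨by linarith, by linarith⟩)
  have hF_lip : LipschitzWith B.toNNReal F := by
    refine LipschitzWith.of_le_add_mul _ fun x y => ?_
    rw [Real.coe_toNNReal B hB, Real.dist_eq]
    rcases le_total x y with h | h
    · rw [abs_sub_comm, abs_of_nonneg (sub_nonneg.mpr h)]
      exact (hF_incr h).2
    · exact (hF_incr h).1.trans (le_add_of_nonneg_right (mul_nonneg hB (abs_nonneg _)))
  refine existsUnique_eq_mul_of_antitone_of_continuous (fun x y h => (hF_incr h).1)
    hF_lip.continuous ?_ hτo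
  rw [hF]
  exact integral_nonneg fun ω => (le_max_right _ _).trans (le_max_right _ _)
end

section
/- Let s₁, s₂ > 0 and let μ be the product measure (gaussianReal 0 (s₁/2)).prod (gaussianReal 0 (s₁/2)) .prod ((gaussianReal 0 (s₂/2)).prod (gaussianReal 0 (s₂/2))) on (ℝ × ℝ) × (ℝ × ℝ). Then ∫ (√(p.1.1² + p.1.2²) · √(p.2.1² + p.2.2²) − (π/4)·√(s₁·s₂))² dμ(p) = (1 − π²/16)·s₁·s₂. -/
open MeasureTheory ProbabilityTheory

/-- The moment of order `q` of the modulus of a circularly symmetric complex Gaussian of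
variance `s`. -/
theorem integral_sqrt_sq_add_sq_rpow_gaussianReal_prod {s q : ℝ} (hs : 0 < s) (hq : -2 < q) :
    ∫ p : ℝ × ℝ, Real.sqrt (p.1 ^ 2 + p.2 ^ 2) ^ q
        ∂((gaussianReal 0 (s / 2).toNNReal).prod (gaussianReal 0 (s / 2).toNNReal))
      = s ^ (q / 2) * Real.Gamma (q / 2 + 1) := by
  have hv : (s / 2).toNNReal ≠ 0 := by simpa using hs
  have hv' : ((s / 2).toNNReal : ℝ) = s / 2 := Real.coe_toNNReal _ (by positivity)
  have hpdf (x y : ℝ) : gaussianPDFReal 0 (s / 2).toNNReal x * gaussianPDFReal 0 (s / 2).toNNReal y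
      = (Real.pi * s)⁻¹ * Real.exp (-s⁻¹ * (x ^ 2 + y ^ 2)) := by
    have hsqrt : Real.sqrt (Real.pi * s) * Real.sqrt (Real.pi * s) = Real.pi * s :=
      Real.mul_self_sqrt (by positivity)
    have hvar : 2 * Real.pi * (s / 2) = Real.pi * s := by ring
    rw [gaussianPDFReal, gaussianPDFReal, hv', hvar, mul_mul_mul_comm, ← mul_inv, hsqrt,
      ← Real.exp_add]
    congr 2
    field_simp
    ring
  rw [gaussianReal_of_var_ne_zero _ hv,
    prod_withDensity (measurable_gaussianPDF _ _) (measurable_gaussianPDF _ _),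
    integral_withDensity_eq_integral_toReal_smul (by fun_prop)
      (ae_of_all _ fun _ ↦ ENNReal.mul_lt_top gaussianPDF_lt_top gaussianPDF_lt_top)]
  simp only [ENNReal.toReal_mul, toReal_gaussianPDF, smul_eq_mul, hpdf]
  rw [← Measure.volume_eq_prod, ← Complex.volume_preserving_equiv_real_prod.integral_comp
    Complex.measurableEquivRealProd.measurableEmbedding]
  have hnorm (z : ℂ) : (Real.pi * s)⁻¹ * Real.exp (-s⁻¹ * (z.re ^ 2 + z.im ^ 2))
        * Real.sqrt (z.re ^ 2 + z.im ^ 2) ^ q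
      = (Real.pi * s)⁻¹ * (‖z‖ ^ q * Real.exp (-s⁻¹ * ‖z‖ ^ (2 : ℝ))) := by
    rw [Complex.norm_eq_sqrt_sq_add_sq, Real.rpow_two, Real.sq_sqrt (by positivity)]
    ring
  simp only [Complex.measurableEquivRealProd_apply, hnorm]
  rw [integral_const_mul,
    Complex.integral_rpow_mul_exp_neg_mul_rpow one_le_two hq (inv_pos.mpr hs),
    Real.inv_rpow hs.le, ← Real.rpow_neg hs.le,
    show -(-(q + 2) / 2) = q / 2 + 1 by ring, show (q + 2) / 2 = q / 2 + 1 by ring,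
    Real.rpow_add_one hs.ne']
  field_simp

theorem integrable_sqrt_sq_add_sq_rpow_gaussianReal_prod {s q : ℝ} (hs : 0 < s) (hq : -2 < q) :
    Integrable (fun p : ℝ × ℝ ↦ Real.sqrt (p.1 ^ 2 + p.2 ^ 2) ^ q)
      ((gaussianReal 0 (s / 2).toNNReal).prod (gaussianReal 0 (s / 2).toNNReal)) := by
  refine Integrable.of_integral_ne_zero ?_
  rw [integral_sqrt_sq_add_sq_rpow_gaussianReal_prod hs hq]
  have := Real.Gamma_pos_of_pos (show 0 < q / 2 + 1 by linarith)
  positivity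

theorem integral_sqrt_sq_add_sq_gaussianReal_prod {s : ℝ} (hs : 0 < s) :
    ∫ p : ℝ × ℝ, Real.sqrt (p.1 ^ 2 + p.2 ^ 2)
        ∂((gaussianReal 0 (s / 2).toNNReal).prod (gaussianReal 0 (s / 2).toNNReal))
      = Real.sqrt s * (Real.sqrt Real.pi / 2) := by
  have h := integral_sqrt_sq_add_sq_rpow_gaussianReal_prod (q := 1) hs (by norm_num)
  simp only [Real.rpow_one] at h
  rw [h, Real.Gamma_add_one (by norm_num), Real.Gamma_one_half_eq, ← Real.sqrt_eq_rpow]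
  ring

theorem integral_sqrt_sq_add_sq_sq_gaussianReal_prod {s : ℝ} (hs : 0 < s) :
    ∫ p : ℝ × ℝ, Real.sqrt (p.1 ^ 2 + p.2 ^ 2) ^ 2
        ∂((gaussianReal 0 (s / 2).toNNReal).prod (gaussianReal 0 (s / 2).toNNReal)) = s := by
  have h := integral_sqrt_sq_add_sq_rpow_gaussianReal_prod (q := 2) hs (by norm_num)
  simp only [Real.rpow_two] at h
  simpa [one_add_one_eq_two] using h

/-- The variance of the cascaded channel gain `|f||g|` of two independent
circularly symmetric complex Gaussians `CN(0, s₁)`, `CN(0, s₂)` is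
`(1 - π²/16)·s₁s₂`. -/
theorem cascaded_channel_gain_variance
    (s₁ s₂ : ℝ) (hs₁ : 0 < s₁) (hs₂ : 0 < s₂)
    (μ : Measure ((ℝ × ℝ) × (ℝ × ℝ)))
    (hμ : μ = ((gaussianReal 0 (s₁ / 2).toNNReal).prod (gaussianReal 0 (s₁ / 2).toNNReal)).prod
        ((gaussianReal 0 (s₂ / 2).toNNReal).prod (gaussianReal 0 (s₂ / 2).toNNReal))) :
    ∫ p, (Real.sqrt (p.1.1 ^ 2 + p.1.2 ^ 2) * Real.sqrt (p.2.1 ^ 2 + p.2.2 ^ 2)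
        - (Real.pi / 4) * Real.sqrt (s₁ * s₂)) ^ 2 ∂μ
      = (1 - Real.pi ^ 2 / 16) * (s₁ * s₂) := by
  subst hμ
  set ν₁ := (gaussianReal 0 (s₁ / 2).toNNReal).prod (gaussianReal 0 (s₁ / 2).toNNReal)
  set ν₂ := (gaussianReal 0 (s₂ / 2).toNNReal).prod (gaussianReal 0 (s₂ / 2).toNNReal)
  let r : ℝ × ℝ → ℝ := fun p ↦ Real.sqrt (p.1 ^ 2 + p.2 ^ 2)
  set c := Real.pi / 4 * Real.sqrt (s₁ * s₂) with hc
  have hr₁ : Integrable r ν₁ := by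
    simpa using integrable_sqrt_sq_add_sq_rpow_gaussianReal_prod (q := 1) hs₁ (by norm_num)
  have hr₂ : Integrable r ν₂ := by
    simpa using integrable_sqrt_sq_add_sq_rpow_gaussianReal_prod (q := 1) hs₂ (by norm_num)
  have hrsq₁ : Integrable (fun p ↦ r p ^ 2) ν₁ := by
    simpa only [Real.rpow_two] using
      integrable_sqrt_sq_add_sq_rpow_gaussianReal_prod (q := 2) hs₁ (by norm_num)
  have hrsq₂ : Integrable (fun p ↦ r p ^ 2) ν₂ := by
    simpa only [Real.rpow_two] using
      integrable_sqrt_sq_add_sq_rpow_gaussianReal_prod (q := 2) hs₂ (by norm_num)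
  have hmean : ∫ p, r p.1 * r p.2 ∂ν₁.prod ν₂ = c := by
    rw [integral_prod_mul, integral_sqrt_sq_add_sq_gaussianReal_prod hs₁,
      integral_sqrt_sq_add_sq_gaussianReal_prod hs₂, hc, Real.sqrt_mul hs₁.le]
    linear_combination
      Real.sqrt s₁ * Real.sqrt s₂ / 4 * Real.mul_self_sqrt Real.pi_pos.le
  have hsq : ∫ p, r p.1 ^ 2 * r p.2 ^ 2 ∂ν₁.prod ν₂ = s₁ * s₂ := by
    rw [integral_prod_mul (fun p ↦ r p ^ 2) (fun p ↦ r p ^ 2),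
      integral_sqrt_sq_add_sq_sq_gaussianReal_prod hs₁,
      integral_sqrt_sq_add_sq_sq_gaussianReal_prod hs₂]
  have hint := hr₁.mul_prod hr₂
  have hintsq := hrsq₁.mul_prod hrsq₂
  have hdiff : Integrable (fun p ↦ r p.1 ^ 2 * r p.2 ^ 2 - 2 * c * (r p.1 * r p.2)) (ν₁.prod ν₂) :=
    hintsq.sub (hint.const_mul _)
  calc ∫ p, (r p.1 * r p.2 - c) ^ 2 ∂ν₁.prod ν₂
      = ∫ p, r p.1 ^ 2 * r p.2 ^ 2 - 2 * c * (r p.1 * r p.2) + c ^ 2 ∂ν₁.prod ν₂ := by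
        congr with p
        ring
    _ = s₁ * s₂ - 2 * c * c + c ^ 2 := by
        rw [integral_add hdiff (integrable_const _),
          integral_sub hintsq (hint.const_mul _), integral_const_mul, hmean, hsq]
        simp
    _ = (1 - Real.pi ^ 2 / 16) * (s₁ * s₂) := by
        rw [hc]
        linear_combination
          -(Real.pi ^ 2 / 16) * Real.sq_sqrt (mul_pos hs₁ hs₂).le
end
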